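/- arXiv:0706.2844 — 2 statements merged into one kernel-verified Lean document; each statement's English description precedes it below -/
import Mathlib

section
/- Let B(n) be the ball of radius n around the identity in a Cayley graph of a finitely generated group of polynomial growth (i.e., a·n^d ≤ V(n) ≤ b·n^d for some constants a, b > 0 and all n ≥ 1, where V(n) = |B(n)|). Then there is a constant β > 0 such that for every positive integer n, the lowest eigenvalue of the Dirichlet Laplacian H^D(B(n)) = 2k·Id − D(B(n)) − A(B(n)) satisfies λ^D(B(n)) ≤ β·k/n². -/
open scoped BigOperators Classical

/-- The Cayley graph of a group with respect to a (symmetric) finite generating set `S`. -/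
def cayleyGraph {Γ : Type*} [Group Γ] (S : Finset Γ) : SimpleGraph Γ :=
  SimpleGraph.fromRel fun x y => x⁻¹ * y ∈ S

open Matrix in
/-- A real symmetric matrix has an eigenvalue bounded by any upper bound for a Rayleigh quotient. -/
theorem Matrix.IsHermitian.exists_eigenvalue_le_of_dotProduct_le {V : Type*} [Fintype V]
    {M : Matrix V V ℝ} (hM : M.IsHermitian) {v : V → ℝ} (hv : v ≠ 0) {c : ℝ}
    (h : v ⬝ᵥ (M *ᵥ v) ≤ c * (v ⬝ᵥ v)) :
    ∃ μ ≤ c, ∃ w : V → ℝ, w ≠ 0 ∧ M *ᵥ w = μ • w := by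
  have hA : (M - c • (1 : Matrix V V ℝ)).IsHermitian := by
    refine hM.sub ?_
    simp [Matrix.IsHermitian]
  have hneg : ∃ i, hA.eigenvalues i ≤ 0 := by
    by_contra! hpos
    have hpd := (hA.posDef_iff_eigenvalues_pos.2 hpos).dotProduct_mulVec_pos hv
    simp only [star_trivial, sub_mulVec, smul_mulVec, one_mulVec, dotProduct_sub,
      dotProduct_smul, smul_eq_mul] at hpd
    linarith
  obtain ⟨i, hi⟩ := hneg
  refine ⟨hA.eigenvalues i + c, by linarith, (hA.eigenvectorBasis i).ofLp, ?_, ?_⟩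
  · intro h0
    apply hA.eigenvectorBasis.orthonormal.ne_zero i
    ext j
    exact congrFun h0 j
  · have hw := hA.mulVec_eigenvectorBasis i
    simp only [sub_mulVec, smul_mulVec, one_mulVec] at hw
    rw [add_smul, ← hw]
    simp

/-- The Dirichlet form of a finite graph of degree at most `k`, evaluated at a `1`-Lipschitz
function vanishing wherever the degree is not `k`, is at most `k` times the number of vertices. -/
theorem SimpleGraph.dirichlet_form_le {V : Type*} [Fintype V] (G : SimpleGraph V) (k : ℝ)
    (D φ : V → ℝ) (hD : ∀ x, D x = ∑ y, if G.Adj x y then (1 : ℝ) else 0)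
    (hDk : ∀ x, D x ≤ k) (hφ : ∀ x, φ x = 0 ∨ D x = k)
    (hlip : ∀ x y, G.Adj x y → |φ x - φ y| ≤ 1) :
    ∑ x, φ x * ((2 * k - D x) * φ x - ∑ y, if G.Adj x y then φ y else 0)
      ≤ k * Fintype.card V := by
  set A : V → V → ℝ := fun x y => if G.Adj x y then 1 else 0 with hA
  have hAs : ∀ x y, A x y = A y x := fun x y => by simp only [hA, G.adj_comm]
  have hDA : ∀ x, D x = ∑ y, A x y := hD
  have hform : ∑ x, φ x * ((2 * k - D x) * φ x - ∑ y, if G.Adj x y then φ y else 0)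
      = ∑ x, D x * φ x ^ 2 - ∑ x, ∑ y, A x y * (φ x * φ y) := by
    rw [← Finset.sum_sub_distrib]
    refine Finset.sum_congr rfl fun x _ => ?_
    have h1 : ∑ y, A x y * (φ x * φ y) = φ x * ∑ y, if G.Adj x y then φ y else 0 := by
      rw [Finset.mul_sum]
      refine Finset.sum_congr rfl fun y _ => ?_
      by_cases hxy : G.Adj x y <;> simp [hA, hxy]
    rw [h1]
    rcases hφ x with h | h
    · simp [h]
    · rw [h]; ring
  have hdiag : ∑ x, ∑ y, A x y * φ x ^ 2 = ∑ x, D x * φ x ^ 2 := by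
    simp only [hDA, Finset.sum_mul]
  have hdiag' : ∑ x, ∑ y, A x y * φ y ^ 2 = ∑ x, D x * φ x ^ 2 := by
    rw [Finset.sum_comm, ← hdiag]
    simp only [hAs]
  have hsq : ∑ x, ∑ y, A x y * (φ x - φ y) ^ 2
      = 2 * (∑ x, D x * φ x ^ 2 - ∑ x, ∑ y, A x y * (φ x * φ y)) := by
    have h2 : ∀ x y, A x y * (φ x - φ y) ^ 2
        = A x y * φ x ^ 2 + A x y * φ y ^ 2 - 2 * (A x y * (φ x * φ y)) := fun x y => by ring
    simp only [h2, Finset.sum_sub_distrib, Finset.sum_add_distrib, ← Finset.mul_sum, hdiag, hdiag']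
    ring
  have hle : ∑ x, ∑ y, A x y * (φ x - φ y) ^ 2 ≤ k * Fintype.card V := by
    calc ∑ x, ∑ y, A x y * (φ x - φ y) ^ 2 ≤ ∑ x, ∑ y, A x y := by
          refine Finset.sum_le_sum fun x _ => Finset.sum_le_sum fun y _ => ?_
          by_cases hxy : G.Adj x y
          · simpa [hA, hxy] using hlip x y hxy
          · simp [hA, hxy]
      _ ≤ ∑ _x : V, k := Finset.sum_le_sum fun x _ => hDA x ▸ hDk x
      _ = k * Fintype.card V := by simp [mul_comm]
  have hnn : 0 ≤ ∑ x, ∑ y, A x y * (φ x - φ y) ^ 2 := by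
    refine Finset.sum_nonneg fun x _ => Finset.sum_nonneg fun y _ => mul_nonneg ?_ (sq_nonneg _)
    simp only [hA]; split_ifs <;> norm_num
  rw [hform]
  linarith

/-- The Cayley graph of a symmetric generating set not containing `1` has neighbours `x * s`. -/
theorem cayleyGraph_neighborSet {Γ : Type*} [Group Γ] (S : Finset Γ) (hS1 : (1 : Γ) ∉ S)
    (hSsym : ∀ s ∈ S, s⁻¹ ∈ S) (x : Γ) :
    (cayleyGraph S).neighborSet x = (fun s => x * s) '' (S : Set Γ) := by
  ext y
  simp only [SimpleGraph.mem_neighborSet, cayleyGraph, SimpleGraph.fromRel_adj, Set.mem_image,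
    Finset.mem_coe]
  constructor
  · rintro ⟨-, h | h⟩
    · exact ⟨_, h, by group⟩
    · exact ⟨_, hSsym _ h, by group⟩
  · rintro ⟨s, hs, rfl⟩
    refine ⟨fun h => hS1 ?_, Or.inl (by simpa using hs)⟩
    rw [← left_eq_mul.1 h]
    exact hs

/-- The Cayley graph of `S` is regular of degree `S.card`. -/
theorem ncard_cayleyGraph_neighborSet {Γ : Type*} [Group Γ] (S : Finset Γ) (hS1 : (1 : Γ) ∉ S)
    (hSsym : ∀ s ∈ S, s⁻¹ ∈ S) (x : Γ) :
    ((cayleyGraph S).neighborSet x).ncard = S.card := by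
  rw [cayleyGraph_neighborSet S hS1 hSsym, Set.ncard_image_of_injective _ (mul_right_injective x),
    Set.ncard_coe_finset]

/-- The squared norm of the tent function `n - dist 1 ·` on `B(n)` is bounded below by
`(n/2)²` times the volume of `B(⌊n/2⌋)`. -/
theorem SimpleGraph.sq_mul_card_le_sum_tent_sq {V : Type*} (G : SimpleGraph V) (o : V) (n : ℕ)
    [Fintype ↥{x : V | G.dist o x ≤ n}] :
    ((n : ℝ) / 2) ^ 2 * (Nat.card {x : V | G.dist o x ≤ n / 2} : ℝ)
      ≤ ∑ x : ↥{x : V | G.dist o x ≤ n}, ((n : ℝ) - G.dist o x) ^ 2 := by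
  have hcard : Nat.card {x : V | G.dist o x ≤ n / 2}
      = (Finset.univ.filter fun x : ↥{x : V | G.dist o x ≤ n} => G.dist o x ≤ n / 2).card := by
    rw [← Fintype.card_subtype, ← Nat.card_eq_fintype_card]
    refine Nat.card_congr (Equiv.symm ?_)
    exact Equiv.subtypeSubtypeEquivSubtype (p := fun x => G.dist o x ≤ n)
      (q := fun x => G.dist o x ≤ n / 2) (fun h => h.trans (Nat.div_le_self _ _))
  rw [hcard, mul_comm, ← nsmul_eq_mul, ← Finset.sum_const]
  refine (Finset.sum_le_sum fun x hx => ?_).trans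
    (Finset.sum_le_sum_of_subset_of_nonneg (Finset.subset_univ _) fun _ _ _ => sq_nonneg _)
  have h2 : 2 * G.dist o x ≤ n := by
    have := (Finset.mem_filter.1 hx).2
    omega
  have h3 : (2 : ℝ) * G.dist o x ≤ n := by exact_mod_cast h2
  gcongr
  linarith

/-- Under polynomial growth, `V(n)` is bounded by a constant multiple of `V(⌊n/2⌋)`. -/
theorem exists_doubling_of_polynomial_growth (V : ℕ → ℝ) (d : ℕ) (a b : ℝ) (ha : 0 < a)
    (hb : 0 < b) (h0 : 1 ≤ V 0)
    (hV : ∀ n : ℕ, 1 ≤ n → a * (n : ℝ) ^ d ≤ V n ∧ V n ≤ b * (n : ℝ) ^ d) :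
    ∃ C : ℝ, 0 < C ∧ ∀ n : ℕ, 1 ≤ n → V n ≤ C * V (n / 2) := by
  refine ⟨b + b * 3 ^ d / a, by positivity, fun n hn => ?_⟩
  rcases hn.eq_or_lt with rfl | hn2
  · have h1 := (hV 1 le_rfl).2
    have h2 : 0 ≤ b * 3 ^ d / a := by positivity
    simp only [Nat.cast_one, one_pow, mul_one] at h1
    norm_num
    nlinarith
  · have hm : 1 ≤ n / 2 := by omega
    have h3 : (n : ℝ) ≤ 3 * (n / 2 : ℕ) := by
      have : n ≤ 3 * (n / 2) := by omega
      exact_mod_cast this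
    have hlow := (hV _ hm).1
    have hpos : 0 ≤ V (n / 2) := le_trans (by positivity) hlow
    calc V n ≤ b * (n : ℝ) ^ d := (hV n hn).2
      _ ≤ b * (3 * (n / 2 : ℕ)) ^ d := by gcongr
      _ = b * 3 ^ d / a * (a * (n / 2 : ℕ) ^ d) := by rw [mul_pow]; field_simp
      _ ≤ b * 3 ^ d / a * V (n / 2) := by gcongr
      _ ≤ (b + b * 3 ^ d / a) * V (n / 2) := by nlinarith

/-- Let `B(n)` be the ball of radius `n` around the identity in a Cayley graph
of a finitely generated group of polynomial growth of order `d`.  Then there is `β > 0` such that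
for every `n ≥ 1` the lowest eigenvalue of the Dirichlet Laplacian
`H^D(B(n)) = 2k·Id − D(B(n)) − A(B(n))` is at most `β·k/n²`
(i.e. some eigenvalue of `H^D(B(n))` is at most `β·k/n²`). -/
theorem dirichlet_laplacian_ball_lowest_eigenvalue_le
    {Γ : Type*} [Group Γ] (S : Finset Γ)
    (hS1 : (1 : Γ) ∉ S) (hSsym : ∀ s ∈ S, s⁻¹ ∈ S) (hSne : S.Nonempty)
    (hgen : Subgroup.closure (S : Set Γ) = ⊤)
    (k : ℕ) (hk : k = S.card)
    (hfin : ∀ n : ℕ, {x : Γ | (cayleyGraph S).dist 1 x ≤ n}.Finite)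
    (d : ℕ) (a b : ℝ) (ha : 0 < a) (hb : 0 < b)
    (hgrowth : ∀ n : ℕ, 1 ≤ n →
      a * (n : ℝ) ^ d ≤ (Nat.card {x : Γ | (cayleyGraph S).dist 1 x ≤ n} : ℝ) ∧
      (Nat.card {x : Γ | (cayleyGraph S).dist 1 x ≤ n} : ℝ) ≤ b * (n : ℝ) ^ d) :
    ∃ β : ℝ, 0 < β ∧ ∀ n : ℕ, 1 ≤ n →
      ∃ μ : ℝ, μ ≤ β * k / (n : ℝ) ^ 2 ∧
        ∃ φ : ↥{x : Γ | (cayleyGraph S).dist 1 x ≤ n} → ℝ, φ ≠ 0 ∧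
          ∀ x : ↥{x : Γ | (cayleyGraph S).dist 1 x ≤ n},
            (2 * (k : ℝ) -
              (Nat.card ↥({y : Γ | (cayleyGraph S).dist 1 y ≤ n} ∩
                (cayleyGraph S).neighborSet ↑x) : ℝ)) * φ x -
              (∑ᶠ y : ↥{x : Γ | (cayleyGraph S).dist 1 x ≤ n},
                if (cayleyGraph S).Adj ↑x ↑y then φ y else 0)
            = μ * φ x := by
  set G := cayleyGraph S with hG
  have hV0 : (1 : ℝ) ≤ Nat.card {x : Γ | G.dist 1 x ≤ 0} := by
    have := (hfin 0).to_subtype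
    have : Nonempty {x : Γ | G.dist 1 x ≤ 0} := ⟨⟨1, by simp⟩⟩
    exact_mod_cast Nat.card_pos
  obtain ⟨C, hC, hdouble⟩ := exists_doubling_of_polynomial_growth
    (fun n => (Nat.card {x : Γ | G.dist 1 x ≤ n} : ℝ)) d a b ha hb hV0 hgrowth
  refine ⟨4 * C, by positivity, fun n hn => ?_⟩
  have hn0 : (0 : ℝ) < n := by exact_mod_cast hn
  let B : Set Γ := {x : Γ | G.dist 1 x ≤ n}
  let _ : Fintype B := (hfin n).fintype
  let D : B → ℝ := fun x => (Nat.card ↥(B ∩ G.neighborSet x) : ℝ)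
  have hnbr_fin : ∀ x, (G.neighborSet x).Finite := fun x => by
    rw [hG, cayleyGraph_neighborSet S hS1 hSsym]
    exact S.finite_toSet.image _
  have hnbr : ∀ x, (G.neighborSet x).ncard = k := fun x => by
    rw [hk]
    exact ncard_cayleyGraph_neighborSet S hS1 hSsym x
  have hD : ∀ x, D x = ∑ y : B, if (G.induce B).Adj x y then (1 : ℝ) else 0 := fun x => by
    simp only [D, Finset.sum_boole, ← Fintype.card_subtype, ← Nat.card_eq_fintype_card]
    congr 1
    exact Nat.card_congr (Equiv.subtypeSubtypeEquivSubtypeInter (· ∈ B) (G.Adj x)).symm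
  have hDk : ∀ x, D x ≤ k := fun x => by
    simp only [D, Nat.card_coe_set_eq]
    exact_mod_cast (Set.ncard_le_ncard Set.inter_subset_right (hnbr_fin x)).trans (hnbr x).le
  let φ : B → ℝ := fun x => (n : ℝ) - G.dist 1 x
  have hφ : ∀ x, φ x = 0 ∨ D x = k := fun x => by
    rcases (show G.dist 1 (x : Γ) ≤ n from x.2).eq_or_lt with h | h
    · left
      simp [φ, h]
    · right
      have hsub : G.neighborSet x ⊆ B := fun y (hy : G.Adj x y) => by
        have := hy.diff_dist_adj (u := 1)
        change G.dist 1 y ≤ n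
        omega
      simp only [D, Nat.card_coe_set_eq, Set.inter_eq_right.2 hsub, hnbr]
  have hlip : ∀ x y, (G.induce B).Adj x y → |φ x - φ y| ≤ 1 := fun x y hxy => by
    have hxy' : G.Adj x y := hxy
    have h := hxy'.diff_dist_adj (u := 1)
    have h1 : G.dist 1 (x : Γ) ≤ G.dist 1 (y : Γ) + 1 := by omega
    have h2 : G.dist 1 (y : Γ) ≤ G.dist 1 (x : Γ) + 1 := by omega
    have h1' : (G.dist 1 (x : Γ) : ℝ) ≤ G.dist 1 (y : Γ) + 1 := by exact_mod_cast h1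
    have h2' : (G.dist 1 (y : Γ) : ℝ) ≤ G.dist 1 (x : Γ) + 1 := by exact_mod_cast h2
    rw [abs_le]
    constructor <;> simp only [φ] <;> linarith
  let M : Matrix B B ℝ := Matrix.diagonal (fun x => 2 * (k : ℝ) - D x) -
    Matrix.of fun x y : B => if G.Adj x y then (1 : ℝ) else 0
  have hM : M.IsHermitian := by
    ext x y
    rcases eq_or_ne x y with rfl | h
    · rfl
    · simp [M, G.adj_comm, h, h.symm]
  have hMv : ∀ (v : B → ℝ) (x : B), M.mulVec v x
      = (2 * (k : ℝ) - D x) * v x - ∑ y : B, if G.Adj x y then v y else 0 := fun v x => by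
    simp only [M, Matrix.sub_mulVec, Pi.sub_apply, Matrix.mulVec_diagonal]
    congr 1
    simp [Matrix.mulVec, dotProduct]
  have hφ0 : φ ≠ 0 := fun h => by
    have h1 : φ ⟨1, by simp [B]⟩ = 0 := congrFun h _
    simp only [φ, SimpleGraph.dist_self, Nat.cast_zero, sub_zero] at h1
    exact hn0.ne' h1
  have hray : φ ⬝ᵥ (M.mulVec φ) ≤ 4 * C * k / (n : ℝ) ^ 2 * (φ ⬝ᵥ φ) := by
    have hform : φ ⬝ᵥ (M.mulVec φ) ≤ k * Fintype.card B := by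
      simp only [dotProduct, hMv]
      exact (G.induce B).dirichlet_form_le k D φ hD hDk hφ hlip
    have hnorm : ((n : ℝ) / 2) ^ 2 * (Nat.card {x : Γ | G.dist 1 x ≤ n / 2} : ℝ) ≤ φ ⬝ᵥ φ := by
      refine (G.sq_mul_card_le_sum_tent_sq 1 n).trans (le_of_eq ?_)
      simp only [dotProduct, φ, ← sq]
      rfl
    calc φ ⬝ᵥ (M.mulVec φ) ≤ k * Fintype.card B := hform
      _ ≤ k * (C * (Nat.card {x : Γ | G.dist 1 x ≤ n / 2} : ℝ)) := by
          rw [← Nat.card_eq_fintype_card]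
          gcongr
          exact hdouble n hn
      _ = 4 * C * k / (n : ℝ) ^ 2 *
            (((n : ℝ) / 2) ^ 2 * (Nat.card {x : Γ | G.dist 1 x ≤ n / 2} : ℝ)) := by
          field_simp
          ring
      _ ≤ 4 * C * k / (n : ℝ) ^ 2 * (φ ⬝ᵥ φ) := by gcongr
  obtain ⟨μ, hμ, w, hw0, hw⟩ := hM.exists_eigenvalue_le_of_dotProduct_le hφ0 hray
  refine ⟨μ, hμ, w, hw0, fun x => ?_⟩
  have hx := congrFun hw x
  rw [hMv, Pi.smul_apply, smul_eq_mul] at hx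
  rw [← hx, finsum_eq_sum_of_fintype]
end

section
/- Let G be a Cayley graph of a finitely generated group with vertex degree k, and suppose the isoperimetric inequality 8k·|∂_V A| ≥ |A|/φ(2|A|) holds for all finite vertex sets A, where φ(t) = min{n ≥ 0 : V(n) > t}. Then for every finite connected subgraph G', the lowest eigenvalue of the adjacency Laplacian satisfies λ^A(G') ≥ 1/(128·k²·φ(2|G'|)²). -/
open scoped BigOperators Classical

theorem cayleyGraph_adj_iff {Γ : Type*} [Group Γ] {S : Finset Γ} (hS1 : (1 : Γ) ∉ S)
    (hSsym : ∀ s ∈ S, s⁻¹ ∈ S) {x y : Γ} : (cayleyGraph S).Adj x y ↔ x⁻¹ * y ∈ S := by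
  simp only [cayleyGraph, SimpleGraph.fromRel_adj]
  constructor
  · rintro ⟨-, h | h⟩
    · exact h
    · simpa using hSsym _ h
  · intro h
    refine ⟨?_, Or.inl h⟩
    rintro rfl
    simp_all

theorem cayleyGraph_reachable_mul {Γ : Type*} [Group Γ] {S : Finset Γ} (hS1 : (1 : Γ) ∉ S)
    (hSsym : ∀ s ∈ S, s⁻¹ ∈ S) (hgen : Subgroup.closure (S : Set Γ) = ⊤) (g x : Γ) :
    (cayleyGraph S).Reachable x (x * g) := by
  have hg : g ∈ Subgroup.closure (S : Set Γ) := hgen ▸ Subgroup.mem_top g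
  induction hg using Subgroup.closure_induction generalizing x with
  | mem s hs =>
    exact SimpleGraph.Adj.reachable ((cayleyGraph_adj_iff hS1 hSsym).2 (by simpa using hs))
  | one => simp
  | mul a b _ _ ha hb => simpa [mul_assoc] using (ha x).trans (hb (x * a))
  | inv a _ ha => simpa using (ha (x * a⁻¹)).symm

section Translation

variable {Γ : Type*} [Group Γ] {f : Γ → ℝ}

theorem summable_mul_translate (hf : f.support.Finite) (g h : Γ) :
    Summable fun x => f (x * g) * f (x * h) := by
  refine summable_of_hasFiniteSupport
    ((hf.preimage (mul_left_injective g).injOn).subset fun x hx => ?_)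
  simp only [Function.mem_support, Set.mem_preimage] at hx ⊢
  exact left_ne_zero_of_mul hx

theorem summable_sub_translate_sq (hf : f.support.Finite) (g h : Γ) :
    Summable fun x => (f (x * g) - f (x * h)) ^ 2 := by
  have := ((summable_mul_translate hf g g).add (summable_mul_translate hf h h)).sub
    ((summable_mul_translate hf g h).mul_left 2)
  refine this.congr fun x => ?_
  ring

theorem tsum_sub_translate_sq (hf : f.support.Finite) (g : Γ) :
    ∑' x, (f x - f (x * g)) ^ 2 = 2 * (∑' x, f x ^ 2) - 2 * ∑' x, f x * f (x * g) := by
  have h1 : Summable fun x => f x ^ 2 := by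
    simpa [sq] using summable_mul_translate hf 1 1
  have hg : Summable fun x => f (x * g) ^ 2 := by
    simpa [sq] using summable_mul_translate hf g g
  have h1g : Summable fun x => f x * f (x * g) := by
    simpa using summable_mul_translate hf 1 g
  have htr : ∑' x, f (x * g) ^ 2 = ∑' x, f x ^ 2 :=
    (Equiv.mulRight g).tsum_eq fun x => f x ^ 2
  calc ∑' x, (f x - f (x * g)) ^ 2
      = ∑' x, ((f x ^ 2 + f (x * g) ^ 2) - 2 * (f x * f (x * g))) :=
        tsum_congr fun x => by ring
    _ = _ := by
        rw [(h1.add hg).tsum_sub (h1g.mul_left 2), h1.tsum_add hg, tsum_mul_left, htr]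
        ring

/-- Moving along a path of length `m` changes a function in `ℓ²` by at most `m` times the largest
change along a generator. -/
theorem tsum_sub_translate_sq_le_of_walk (hf : f.support.Finite) {S : Finset Γ}
    (hS1 : (1 : Γ) ∉ S) (hSsym : ∀ s ∈ S, s⁻¹ ∈ S) {M : ℝ}
    (hM : ∀ s ∈ S, ∑' x, (f x - f (x * s)) ^ 2 ≤ M) {a b : Γ} (p : (cayleyGraph S).Walk a b) :
    ∑' x, (f x - f (x * (a⁻¹ * b))) ^ 2 ≤ (p.length : ℝ) ^ 2 * M := by
  induction p with
  | nil => simp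
  | @cons u v w huv q ih =>
    set s := u⁻¹ * v with hs
    set g := v⁻¹ * w with hg
    have hsS : s ∈ S := (cayleyGraph_adj_iff hS1 hSsym).1 huv
    have hsg : u⁻¹ * w = s * g := by simp [hs, hg, mul_assoc]
    have hstep := hM s hsS
    have htr : ∑' x, (f (x * s) - f (x * (s * g))) ^ 2 = ∑' x, (f x - f (x * g)) ^ 2 := by
      simpa [mul_assoc] using (Equiv.mulRight s).tsum_eq fun x => (f x - f (x * g)) ^ 2
    rw [hsg, SimpleGraph.Walk.length_cons]
    rcases Nat.eq_zero_or_pos q.length with h0 | hpos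
    · have hvw : v = w := SimpleGraph.Walk.eq_of_length_eq_zero h0
      have hg1 : g = 1 := by simp [hg, hvw]
      simpa [h0, hg1] using hstep
    · have hm : (0 : ℝ) < q.length := by exact_mod_cast hpos
      set m := (q.length : ℝ) with hmdef
      have hsum1 : Summable fun x => (f x - f (x * s)) ^ 2 := by
        simpa using summable_sub_translate_sq hf 1 s
      have hsum2 := summable_sub_translate_sq hf s (s * g)
      have hsum : Summable fun x => (f x - f (x * (s * g))) ^ 2 := by
        simpa using summable_sub_translate_sq hf 1 (s * g)
      calc ∑' x, (f x - f (x * (s * g))) ^ 2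
          ≤ ∑' x, ((1 + m) * (f x - f (x * s)) ^ 2
              + (1 + m⁻¹) * (f (x * s) - f (x * (s * g))) ^ 2) := by
            refine hsum.tsum_le_tsum (fun x => ?_) ((hsum1.mul_left _).add (hsum2.mul_left _))
            generalize f x = a, f (x * s) = b, f (x * (s * g)) = c
            have : (1 + m) * (a - b) ^ 2 + (1 + m⁻¹) * (b - c) ^ 2 - (a - c) ^ 2
                = m⁻¹ * (m * (a - b) - (b - c)) ^ 2 := by
              field_simp
              ring
            have : 0 ≤ m⁻¹ * (m * (a - b) - (b - c)) ^ 2 := by positivity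
            linarith
        _ = (1 + m) * ∑' x, (f x - f (x * s)) ^ 2
              + (1 + m⁻¹) * ∑' x, (f x - f (x * g)) ^ 2 := by
            rw [(hsum1.mul_left _).tsum_add (hsum2.mul_left _), tsum_mul_left, tsum_mul_left, htr]
        _ ≤ (1 + m) * M + (1 + m⁻¹) * (m ^ 2 * M) := by gcongr
        _ = ((q.length + 1 : ℕ) : ℝ) ^ 2 * M := by
            push_cast
            rw [← hmdef]
            field_simp
            ring

theorem sum_tsum_mul_translate_le {C : Finset Γ} (hfC : ∀ x ∉ C, f x = 0) (B : Finset Γ) :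
    ∑ g ∈ B, ∑' x, f x * f (x * g) ≤ C.card * ∑' x, f x ^ 2 := by
  have hB : ∀ x, ∑ g ∈ B, |f (x * g)| ≤ ∑ y ∈ C, |f y| := fun x => by
    rw [← Finset.sum_image (f := fun y => |f y|) (g := fun g => x * g)
      (fun a _ b _ h => mul_left_cancel h)]
    calc _ ≤ ∑ y ∈ (B.image fun g => x * g) ∪ C, |f y| :=
          Finset.sum_le_sum_of_subset_of_nonneg Finset.subset_union_left
            fun _ _ _ => abs_nonneg _
      _ = _ := (Finset.sum_subset Finset.subset_union_right fun y _ hy => by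
          simp [hfC y hy]).symm
  calc ∑ g ∈ B, ∑' x, f x * f (x * g)
      = ∑ g ∈ B, ∑ x ∈ C, f x * f (x * g) := by
        refine Finset.sum_congr rfl fun g _ => tsum_eq_sum fun x hx => ?_
        simp [hfC x hx]
    _ ≤ ∑ g ∈ B, ∑ x ∈ C, |f x| * |f (x * g)| := by
        exact Finset.sum_le_sum fun g _ => Finset.sum_le_sum fun x _ =>
          (le_abs_self _).trans_eq (abs_mul _ _)
    _ = ∑ x ∈ C, |f x| * ∑ g ∈ B, |f (x * g)| := by
        rw [Finset.sum_comm]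
        simp only [Finset.mul_sum]
    _ ≤ ∑ x ∈ C, |f x| * ∑ y ∈ C, |f y| := by
        gcongr with x _
        exact hB x
    _ = (∑ x ∈ C, |f x|) ^ 2 := by rw [← Finset.sum_mul, sq]
    _ ≤ C.card * ∑ x ∈ C, |f x| ^ 2 := sq_sum_le_card_mul_sum_sq
    _ = C.card * ∑' x, f x ^ 2 := by
        rw [tsum_eq_sum (s := C) fun x hx => by simp [hfC x hx]]
        simp

/-- An `ℓ²` Poincaré inequality: a function supported on at most half as many points as a set `B`
of translations is moved a definite amount by them on average. -/
theorem tsum_sq_le_of_translate_le (hf : f.support.Finite) {C B : Finset Γ}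
    (hfC : ∀ x ∉ C, f x = 0) (hCB : 2 * C.card < B.card) {K : ℝ}
    (hK : ∀ g ∈ B, ∑' x, (f x - f (x * g)) ^ 2 ≤ K) : ∑' x, f x ^ 2 ≤ K := by
  have hsum := Finset.sum_le_sum hK
  simp only [tsum_sub_translate_sq hf, Finset.sum_sub_distrib, ← Finset.mul_sum,
    Finset.sum_const, nsmul_eq_mul] at hsum
  have hle := sum_tsum_mul_translate_le hfC B
  have hA : 0 ≤ ∑' x, f x ^ 2 := tsum_nonneg fun x => sq_nonneg _
  have hc : (2 : ℝ) * C.card ≤ B.card := by exact_mod_cast hCB.le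
  have hBpos : (0 : ℝ) < B.card := by exact_mod_cast (Nat.zero_le _).trans_lt hCB
  refine le_of_mul_le_mul_left ?_ hBpos
  nlinarith [mul_le_mul_of_nonneg_right hc hA]

end Translation

/-- On a Cayley graph of a finitely generated group with vertex degree `k`,
assume the isoperimetric inequality `8k·|∂_V A| ≥ |A|/φ(2|A|)` for all finite vertex sets `A`,
where `φ(t) = min{n ≥ 0 : V(n) > t}` and `V(n)` is the volume of the ball of radius `n`.
Then every nonzero eigenvalue `μ` of the adjacency Laplacian `H^A(G') = k·Id − A(G')` of a finite
connected subgraph `G'` satisfies `μ ≥ 1/(128·k²·φ(2|G'|)²)`. -/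
theorem faber_krahn_adjacency_laplacian
    {Γ : Type*} [Group Γ] (S : Finset Γ)
    (hS1 : (1 : Γ) ∉ S) (hSsym : ∀ s ∈ S, s⁻¹ ∈ S) (hSne : S.Nonempty)
    (hgen : Subgroup.closure (S : Set Γ) = ⊤)
    (k : ℕ) (hk : k = S.card)
    (hfin : ∀ n : ℕ, {x : Γ | (cayleyGraph S).dist 1 x ≤ n}.Finite)
    (phi : ℕ → ℕ)
    (hphi : ∀ t : ℕ,
      phi t = sInf {n : ℕ | t < Nat.card {x : Γ | (cayleyGraph S).dist 1 x ≤ n}})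
    (hiso : ∀ A : Finset Γ, A.Nonempty →
      (A.card : ℝ) / (phi (2 * A.card) : ℝ) ≤
        8 * k * ((A.filter fun x => ∃ y, y ∉ A ∧ (cayleyGraph S).Adj x y).card : ℝ))
    (C : Set Γ) (hCfin : C.Finite) (hCne : C.Nonempty)
    (hCconn : ((cayleyGraph S).induce C).Connected)
    (μ : ℝ) (hμ : μ ≠ 0) (φ : ↥C → ℝ) (hφ : φ ≠ 0)
    (heig : ∀ x : ↥C,
      (k : ℝ) * φ x - (∑ᶠ y : ↥C, if (cayleyGraph S).Adj ↑x ↑y then φ y else 0) = μ * φ x) :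
    1 / (128 * (k : ℝ) ^ 2 * (phi (2 * Nat.card C) : ℝ) ^ 2) ≤ μ := by
  set f : Γ → ℝ := fun x => if h : x ∈ C then φ ⟨x, h⟩ else 0 with hfdef
  have hfφ : ∀ x : ↥C, f x = φ x := fun x => by simp [hfdef]
  set C' : Finset Γ := hCfin.toFinset with hC'
  have hfC : ∀ x ∉ C', f x = 0 := fun x hx => dif_neg (by simpa [hC'] using hx)
  have hf : f.support.Finite := hCfin.subset fun x hx => by
    by_contra h
    exact hx (dif_neg h)
  have hadj : ∀ x y, (cayleyGraph S).Adj x y ↔ x⁻¹ * y ∈ S := fun x y =>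
    cayleyGraph_adj_iff hS1 hSsym
  have hnbr : ∀ x : ↥C, (∑ᶠ y : ↥C, if (cayleyGraph S).Adj ↑x ↑y then φ y else 0)
      = ∑ s ∈ S, f (x * s) := fun x => by
    have : Fintype ↥C := hCfin.fintype
    calc (∑ᶠ y : ↥C, if (cayleyGraph S).Adj ↑x ↑y then φ y else 0)
        = ∑ y : ↥C, if (x : Γ)⁻¹ * y ∈ S then f y else 0 := by
          rw [finsum_eq_sum_of_fintype]
          simp only [hadj, hfφ]
      _ = ∑ y ∈ C', if (x : Γ)⁻¹ * y ∈ S then f y else 0 :=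
          (Finset.sum_subtype C' (by simp [hC'])
            fun y : Γ => if (x : Γ)⁻¹ * y ∈ S then f y else 0).symm
      _ = ∑' y, if (x : Γ)⁻¹ * y ∈ S then f y else 0 :=
          (tsum_eq_sum fun y hy => by simp [hfC y hy]).symm
      _ = ∑' s, if s ∈ S then f (x * s) else 0 := by
          simpa using ((Equiv.mulLeft (x : Γ)).tsum_eq
            fun y => if (x : Γ)⁻¹ * y ∈ S then f y else 0).symm
      _ = ∑ s ∈ S, f (x * s) := by
          rw [tsum_eq_sum (s := S) fun s hs => if_neg hs]
          exact Finset.sum_congr rfl fun s hs => if_pos hs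
  have hpt : ∀ x, k * f x ^ 2 - ∑ s ∈ S, f x * f (x * s) = μ * f x ^ 2 := fun x => by
    by_cases hx : x ∈ C
    · have h := heig ⟨x, hx⟩
      rw [hnbr, ← hfφ] at h
      rw [← Finset.mul_sum]
      linear_combination f x * h
    · simp [hfdef, hx]
  set A : ℝ := ∑' x, f x ^ 2 with hA
  have hsumA : Summable fun x => f x ^ 2 := by
    simpa [sq] using summable_mul_translate hf 1 1
  have hsums : ∀ s, Summable fun x => f x * f (x * s) := fun s => by
    simpa using summable_mul_translate hf 1 s
  have henergy : k * A - ∑ s ∈ S, ∑' x, f x * f (x * s) = μ * A := by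
    rw [← Summable.tsum_finsetSum fun s _ => hsums s, hA, ← tsum_mul_left, ← tsum_mul_left,
      ← (hsumA.mul_left _).tsum_sub (summable_sum fun s _ => hsums s)]
    exact tsum_congr hpt
  have hdir : ∑ s ∈ S, ∑' x, (f x - f (x * s)) ^ 2 = 2 * μ * A := by
    simp only [tsum_sub_translate_sq hf, Finset.sum_sub_distrib, ← Finset.mul_sum,
      Finset.sum_const, nsmul_eq_mul, ← hk, ← hA]
    linear_combination 2 * henergy
  have hnonneg : ∀ s, 0 ≤ ∑' x, (f x - f (x * s)) ^ 2 := fun s =>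
    tsum_nonneg fun x => sq_nonneg _
  have hgrad : ∀ s ∈ S, ∑' x, (f x - f (x * s)) ^ 2 ≤ 2 * μ * A := fun s hs =>
    hdir ▸ Finset.single_le_sum (f := fun s => ∑' x, (f x - f (x * s)) ^ 2)
      (fun s _ => hnonneg s) hs
  have hApos : 0 < A := by
    obtain ⟨x, hx⟩ := Function.ne_iff.1 hφ
    refine hsumA.tsum_pos (fun y => sq_nonneg _) x ?_
    have : f x ≠ 0 := by simpa [hfφ] using hx
    positivity
  have hμ0 : 0 ≤ μ := by
    have h : 0 ≤ 2 * μ * A := hdir ▸ Finset.sum_nonneg fun s _ => hnonneg s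
    nlinarith
  set n := phi (2 * Nat.card C) with hn
  rcases Nat.eq_zero_or_pos n with h0 | hnpos
  · simpa [h0] using hμ0
  have hball : 2 * Nat.card C < Nat.card {x : Γ | (cayleyGraph S).dist 1 x ≤ n} := by
    have hne : {m : ℕ | 2 * Nat.card C < Nat.card {x : Γ | (cayleyGraph S).dist 1 x ≤ m}}.Nonempty :=
      Nat.nonempty_of_pos_sInf (hphi (2 * Nat.card C) ▸ hnpos)
    have := Nat.sInf_mem hne
    rwa [← hphi] at this
  have hcard : 2 * C'.card < (hfin n).toFinset.card := by
    rwa [Nat.card_coe_set_eq, Nat.card_coe_set_eq, Set.ncard_eq_toFinset_card _ hCfin,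
      Set.ncard_eq_toFinset_card _ (hfin n)] at hball
  have hmain : A ≤ (n : ℝ) ^ 2 * (2 * μ * A) := by
    refine tsum_sq_le_of_translate_le hf hfC hcard fun g hg => ?_
    have hgn : (cayleyGraph S).dist 1 g ≤ n := by simpa using hg
    have hreach : (cayleyGraph S).Reachable 1 g := by
      simpa using cayleyGraph_reachable_mul hS1 hSsym hgen g 1
    obtain ⟨p, hp⟩ := hreach.exists_walk_length_eq_dist
    have h := tsum_sub_translate_sq_le_of_walk hf hS1 hSsym hgrad p
    rw [inv_one, one_mul, hp] at h
    refine h.trans ?_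
    gcongr
  have hnR : (1 : ℝ) ≤ n := by exact_mod_cast hnpos
  have hkR : (1 : ℝ) ≤ k := by
    rw [hk]
    exact_mod_cast hSne.card_pos
  have hbound : 1 ≤ 2 * μ * (n : ℝ) ^ 2 := by
    refine le_of_mul_le_mul_right ?_ hApos
    linarith
  rw [div_le_iff₀ (by positivity)]
  nlinarith [mul_nonneg (mul_nonneg hμ0 (sq_nonneg (n : ℝ)))
    (by nlinarith : (0 : ℝ) ≤ (k : ℝ) ^ 2 - 1)]
end
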